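/- For every k ≥ 2, the minimum number of links of a CLOSED polygonal chain in ℝ^k covering the vertex set H(2,k) = {0,1}^k equals 3·2^{k−2}; in particular, restricting to closed chains (cycles) does not increase the minimum link-length of a covering polygonal chain for {0,1}^k. -/

import Mathlib

/-- Rounding of a point of `ℝ^k` to a vertex of the unit hypercube. -/
noncomputable def cubeRound {k : ℕ} (x : Fin k → ℝ) : Fin k → ℝ :=
  fun i => if 1 ≤ x i then 1 else 0

/-- The vertex set of the `k`-dimensional unit hypercube. -/
noncomputable def cubeVertices (k : ℕ) : Finset (Fin k → ℝ) :=
  Fintype.piFinset fun _ => {0, 1}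

theorem mem_cubeVertices {k : ℕ} {v : Fin k → ℝ} :
    v ∈ cubeVertices k ↔ ∀ i, v i = 0 ∨ v i = 1 := by
  simp [cubeVertices]

theorem card_cubeVertices (k : ℕ) : (cubeVertices k).card = 2 ^ k := by
  simp [cubeVertices, Fintype.card_piFinset]

open Classical in
/-- The vertices of the unit hypercube lying on the segment from `A` to `B`. -/
noncomputable def linkVertices {k : ℕ} (A B : Fin k → ℝ) : Finset (Fin k → ℝ) :=
  (cubeVertices k).filter (· ∈ segment ℝ A B)

theorem mem_linkVertices {k : ℕ} {A B v : Fin k → ℝ} :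
    v ∈ linkVertices A B ↔ v ∈ cubeVertices k ∧ v ∈ segment ℝ A B := by
  simp [linkVertices]

theorem linkVertices_comm {k : ℕ} (A B : Fin k → ℝ) : linkVertices A B = linkVertices B A := by
  ext v
  rw [mem_linkVertices, mem_linkVertices, segment_symm]

/-- A point on the ray from `x` through `y`, at or beyond `y`, rounds to `y`. -/
theorem cubeRound_eq_of_ray {k : ℕ} {x y B : Fin k → ℝ} {h : ℝ} (hx : x ∈ cubeVertices k)
    (hy : y ∈ cubeVertices k) (hh : 0 ≤ h) (hB : ∀ i, B i = y i + h * (y i - x i)) :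
    cubeRound B = y := by
  rw [mem_cubeVertices] at hx hy
  ext i
  have hBi := hB i
  unfold cubeRound
  rcases hx i with hxi | hxi <;> rcases hy i with hyi | hyi <;> rw [hxi, hyi] at hBi <;>
    rw [hyi] <;> split_ifs <;> linarith

/-- Two distinct points of a segment, suitably ordered, extrapolate to its endpoints. -/
theorem exists_extrapolation_of_mem_segment {k : ℕ} {A B x y : Fin k → ℝ}
    (hx : x ∈ segment ℝ A B) (hy : y ∈ segment ℝ A B) (hxy : x ≠ y) :
    ∃ g h : ℝ, 0 ≤ g ∧ 0 ≤ h ∧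
      (((∀ i, A i = x i + g * (x i - y i)) ∧ ∀ i, B i = y i + h * (y i - x i)) ∨
        ((∀ i, A i = y i + g * (y i - x i)) ∧ ∀ i, B i = x i + h * (x i - y i))) := by
  rw [segment_eq_image] at hx hy
  obtain ⟨α, ⟨hα0, hα1⟩, rfl⟩ := hx
  obtain ⟨β, ⟨hβ0, hβ1⟩, rfl⟩ := hy
  have hαβ : α ≠ β := fun h => hxy (by rw [h])
  rcases lt_or_gt_of_ne hαβ with hlt | hlt
  · have hpos : 0 < β - α := by linarith
    refine ⟨α / (β - α), (1 - β) / (β - α), by positivity,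
      div_nonneg (by linarith) hpos.le, Or.inl ⟨fun i => ?_, fun i => ?_⟩⟩ <;>
    · simp only [Pi.add_apply, Pi.smul_apply, smul_eq_mul]
      field_simp
      ring
  · have hpos : 0 < α - β := by linarith
    refine ⟨β / (α - β), (1 - α) / (α - β), by positivity,
      div_nonneg (by linarith) hpos.le, Or.inr ⟨fun i => ?_, fun i => ?_⟩⟩ <;>
    · simp only [Pi.add_apply, Pi.smul_apply, smul_eq_mul]
      field_simp
      ring

/-- If a segment contains two distinct hypercube vertices, then they are the roundings of its
endpoints, and they extrapolate to the endpoints. -/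
theorem linkVertices_of_card {k : ℕ} {A B : Fin k → ℝ} (h2 : 1 < (linkVertices A B).card) :
    linkVertices A B = {cubeRound A, cubeRound B} ∧
      ∃ g h : ℝ, 0 ≤ g ∧ 0 ≤ h ∧
        (∀ i, A i = cubeRound A i + g * (cubeRound A i - cubeRound B i)) ∧
        ∀ i, B i = cubeRound B i + h * (cubeRound B i - cubeRound A i) := by
  have key : ∀ x ∈ linkVertices A B, ∀ y ∈ linkVertices A B, x ≠ y →
      ∃ g h : ℝ, 0 ≤ g ∧ 0 ≤ h ∧
        (∀ i, A i = cubeRound A i + g * (cubeRound A i - cubeRound B i)) ∧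
        (∀ i, B i = cubeRound B i + h * (cubeRound B i - cubeRound A i)) ∧
        ((cubeRound A = x ∧ cubeRound B = y) ∨ (cubeRound A = y ∧ cubeRound B = x)) := by
    intro x hx y hy hxy
    rw [mem_linkVertices] at hx hy
    obtain ⟨g, h, hg, hh, ⟨hA, hB⟩ | ⟨hA, hB⟩⟩ :=
      exists_extrapolation_of_mem_segment hx.2 hy.2 hxy
    · have hA' := cubeRound_eq_of_ray hy.1 hx.1 hg hA
      have hB' := cubeRound_eq_of_ray hx.1 hy.1 hh hB
      exact ⟨g, h, hg, hh, by rw [hA', hB']; exact hA, by rw [hA', hB']; exact hB,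
        Or.inl ⟨hA', hB'⟩⟩
    · have hA' := cubeRound_eq_of_ray hx.1 hy.1 hg hA
      have hB' := cubeRound_eq_of_ray hy.1 hx.1 hh hB
      exact ⟨g, h, hg, hh, by rw [hA', hB']; exact hA, by rw [hA', hB']; exact hB,
        Or.inr ⟨hA', hB'⟩⟩
  obtain ⟨x, hx, y, hy, hxy⟩ := Finset.one_lt_card.mp h2
  obtain ⟨g, h, hg, hh, hA, hB, hr⟩ := key x hx y hy hxy
  refine ⟨?_, g, h, hg, hh, hA, hB⟩
  ext z
  rw [Finset.mem_insert, Finset.mem_singleton]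
  constructor
  · intro hz
    by_cases hzx : z = x
    · rcases hr with hr | hr
      · exact Or.inl (hzx.trans hr.1.symm)
      · exact Or.inr (hzx.trans hr.2.symm)
    · obtain ⟨-, -, -, -, -, -, hr' | hr'⟩ := key z hz x hx hzx
      · exact Or.inl hr'.1.symm
      · exact Or.inr hr'.2.symm
  · rintro (rfl | rfl) <;> rcases hr with ⟨h1, h2⟩ | ⟨h1, h2⟩ <;> simp only [h1, h2, hx, hy]

theorem card_linkVertices_le_two {k : ℕ} (A B : Fin k → ℝ) : (linkVertices A B).card ≤ 2 := by
  by_cases h : 1 < (linkVertices A B).card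
  · rw [(linkVertices_of_card h).1]
    exact Finset.card_le_two
  · omega

/-- The coordinatewise constraints on two lines `ab`, `cd` whose extrapolations are joined by a
segment through a vertex `e`; here `p = u * g` and `q = (1 - u) * h`. -/
theorem coordinate_constraints {a b c d e u p q : ℝ} (ha : a = 0 ∨ a = 1) (hb : b = 0 ∨ b = 1)
    (hc : c = 0 ∨ c = 1) (hd : d = 0 ∨ d = 1) (he : e = 0 ∨ e = 1) (hu : 0 < u) (hu1 : u < 1)
    (hp : 0 < p) (hq : 0 < q)
    (h : e = (1 - u) * b + q * (b - a) + u * c + p * (c - d)) :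
    (a ≠ c → u + p = 1) ∧ (b ≠ d → q = u) ∧ (a ≠ d → 1 - u + q - p = 0 ∨ 1 - u + q - p = 1) := by
  rcases ha with rfl | rfl <;> rcases hb with rfl | rfl <;> rcases hc with rfl | rfl <;>
    rcases hd with rfl | rfl <;> rcases he with rfl | rfl <;>
    first
    | (exfalso; linarith)
    | (refine ⟨fun hne => ?_, fun hne => ?_, fun hne => ?_⟩ <;>
        first
        | exact absurd rfl hne
        | linarith
        | (left; linarith)
        | (right; linarith))

/-- If two links carrying two hypercube vertices each are joined by a link passing through a
single vertex, then the vertices involved are not all distinct. -/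
theorem vertices_of_joined_links {k : ℕ} {a b c d e B C : Fin k → ℝ} {g h : ℝ}
    (ha : a ∈ cubeVertices k) (hb : b ∈ cubeVertices k) (hc : c ∈ cubeVertices k)
    (hd : d ∈ cubeVertices k) (he : e ∈ cubeVertices k) (hh : 0 ≤ h) (hg : 0 ≤ g)
    (hB : ∀ i, B i = b i + h * (b i - a i)) (hC : ∀ i, C i = c i + g * (c i - d i))
    (heBC : e ∈ segment ℝ B C) (hcard : (linkVertices B C).card ≤ 1) :
    e = b ∨ e = c ∨ a = c ∨ b = d ∨ a = d := by
  have huniq := Finset.card_le_one.mp hcard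
  have he' : e ∈ linkVertices B C := mem_linkVertices.mpr ⟨he, heBC⟩
  rcases hh.eq_or_lt with rfl | hh
  · left
    have hBb : B = b := by ext i; simpa using hB i
    exact huniq e he' b (mem_linkVertices.mpr ⟨hb, hBb ▸ left_mem_segment ℝ B C⟩)
  rcases hg.eq_or_lt with rfl | hg
  · right; left
    have hCc : C = c := by ext i; simpa using hC i
    exact huniq e he' c (mem_linkVertices.mpr ⟨hc, hCc ▸ right_mem_segment ℝ B C⟩)
  have hround : cubeRound e = e :=
    cubeRound_eq_of_ray (h := 0) he he le_rfl fun i => by simp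
  rw [segment_eq_image] at heBC
  obtain ⟨u, ⟨hu0, hu1⟩, hue⟩ := heBC
  simp only at hue
  rcases hu0.eq_or_lt with rfl | hu0
  · left
    have : e = B := by rw [← hue]; simp
    rw [← hround, this]
    exact cubeRound_eq_of_ray ha hb hh.le hB
  rcases hu1.eq_or_lt with rfl | hu1
  · right; left
    have : e = C := by rw [← hue]; simp
    rw [← hround, this]
    exact cubeRound_eq_of_ray hd hc hg.le hC
  right; right
  rw [mem_cubeVertices] at ha hb hc hd he
  have hq : 0 < (1 - u) * h := mul_pos (by linarith) hh
  have hp : 0 < u * g := mul_pos hu0 hg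
  have key := fun i => coordinate_constraints (ha i) (hb i) (hc i) (hd i) (he i) hu0 hu1 hp hq (by
    have := congrFun hue i
    simp only [Pi.add_apply, Pi.smul_apply, smul_eq_mul, hB, hC] at this
    rw [← this]; ring)
  by_contra! hne
  obtain ⟨i, hi⟩ := Function.ne_iff.mp hne.1
  obtain ⟨j, hj⟩ := Function.ne_iff.mp hne.2.1
  obtain ⟨l, hl⟩ := Function.ne_iff.mp hne.2.2
  have h1 := (key i).1 hi
  have h2 := (key j).2.1 hj
  rcases (key l).2.2 hl with h3 | h3 <;> linarith

/-- Two consecutive links cover at most three vertices of the hypercube. -/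
theorem card_two_links_le {k : ℕ} (A B C : Fin k → ℝ) :
    (linkVertices A B ∪ linkVertices B C).card ≤ 3 := by
  have c1 := card_linkVertices_le_two A B
  have c2 := card_linkVertices_le_two B C
  have u := Finset.card_union_le (linkVertices A B) (linkVertices B C)
  by_cases h1 : 1 < (linkVertices A B).card <;> by_cases h2 : 1 < (linkVertices B C).card <;>
    try omega
  calc _ ≤ ({cubeRound A, cubeRound B, cubeRound C} : Finset (Fin k → ℝ)).card := by
        rw [(linkVertices_of_card h1).1, (linkVertices_of_card h2).1]
        apply Finset.card_le_card
        intro x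
        simp only [Finset.mem_union, Finset.mem_insert, Finset.mem_singleton]
        tauto
    _ ≤ 3 := Finset.card_le_three

/-- Three consecutive links cover at most four vertices of the hypercube. -/
theorem card_three_links_le {k : ℕ} (A B C D : Fin k → ℝ) :
    (linkVertices A B ∪ linkVertices B C ∪ linkVertices C D).card ≤ 4 := by
  have c1 := card_linkVertices_le_two A B
  have c2 := card_linkVertices_le_two B C
  have c3 := card_linkVertices_le_two C D
  have u12 := card_two_links_le A B C
  have u13 := Finset.card_union_add_card_inter (linkVertices A B) (linkVertices C D)
  have u23 := card_two_links_le B C D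
  have u12_3 := Finset.card_union_le (linkVertices A B ∪ linkVertices B C) (linkVertices C D)
  have u1_23 := Finset.card_union_le (linkVertices A B) (linkVertices B C ∪ linkVertices C D)
  rw [← Finset.union_assoc] at u1_23
  by_cases h1 : 1 < (linkVertices A B).card <;> by_cases h3 : 1 < (linkVertices C D).card <;>
    by_cases h2 : 1 < (linkVertices B C).card <;> try omega
  · calc _ ≤ ({cubeRound A, cubeRound B, cubeRound C, cubeRound D} : Finset (Fin k → ℝ)).card := by
          rw [(linkVertices_of_card h1).1, (linkVertices_of_card h2).1,
            (linkVertices_of_card h3).1]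
          apply Finset.card_le_card
          intro x
          simp only [Finset.mem_union, Finset.mem_insert, Finset.mem_singleton]
          tauto
      _ ≤ 4 := Finset.card_le_four
  · obtain ⟨e1, g1, h1', -, hh, -, hB⟩ := linkVertices_of_card h1
    obtain ⟨e3, g3, h3', hg, -, hC, -⟩ := linkVertices_of_card h3
    have mem1 : ∀ x ∈ linkVertices A B, x ∈ cubeVertices k := fun x hx => (mem_linkVertices.mp hx).1
    have mem3 : ∀ x ∈ linkVertices C D, x ∈ cubeVertices k := fun x hx => (mem_linkVertices.mp hx).1
    by_cases hi : (linkVertices A B ∩ linkVertices C D).Nonempty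
    · have hpos := hi.card_pos
      have : (linkVertices A B ∪ linkVertices B C ∪ linkVertices C D).card ≤
          (linkVertices A B ∪ linkVertices C D).card + (linkVertices B C).card := by
        rw [Finset.union_right_comm]
        exact Finset.card_union_le _ _
      omega
    · have hsub : linkVertices B C ⊆ linkVertices A B ∪ linkVertices C D := by
        intro e he
        obtain ⟨he1, he2⟩ := mem_linkVertices.mp he
        have hcases := vertices_of_joined_links (mem1 (cubeRound A) (by simp [e1]))
          (mem1 (cubeRound B) (by simp [e1])) (mem3 (cubeRound C) (by simp [e3]))
          (mem3 (cubeRound D) (by simp [e3])) he1 hh hg hB hC he2 (by omega)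
        rw [e1, e3] at hi ⊢
        rcases hcases with h | h | h | h | h
        · simp [h]
        · simp [h]
        · exact absurd ⟨cubeRound A, by simp [h]⟩ hi
        · exact absurd ⟨cubeRound B, by simp [h]⟩ hi
        · exact absurd ⟨cubeRound A, by simp [h]⟩ hi
      calc _ ≤ (linkVertices A B ∪ linkVertices C D).card := by
            apply Finset.card_le_card
            rw [Finset.union_right_comm]
            exact Finset.union_subset subset_rfl hsub
        _ ≤ 4 := by omega

/-- A cyclic polygon with at least three links covering the hypercube vertices has at least
`3 / 4` as many links as there are vertices. -/
theorem three_mul_two_pow_le_of_cyclic_cover {k n : ℕ} (N : Fin (n + 3) → Fin k → ℝ)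
    (hN : ∀ v ∈ cubeVertices k, ∃ j, v ∈ segment ℝ (N j) (N (j + 1))) :
    3 * 2 ^ k ≤ 4 * (n + 3) := by
  classical
  choose! φ hφ using hN
  let X : Fin (n + 3) → Finset (Fin k → ℝ) := fun j => (cubeVertices k).filter (φ · = j)
  have hX : ∀ j, X j ⊆ linkVertices (N j) (N (j + 1)) := by
    intro j v hv
    obtain ⟨hv', rfl⟩ := Finset.mem_filter.mp hv
    exact mem_linkVertices.mpr ⟨hv', hφ v hv'⟩
  have hdisj : ∀ i j, i ≠ j → Disjoint (X i) (X j) := by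
    intro i j hij
    rw [Finset.disjoint_left]
    intro v hi hj
    exact hij ((Finset.mem_filter.mp hi).2.symm.trans (Finset.mem_filter.mp hj).2)
  have hsum : ∑ j, (X j).card = 2 ^ k := by
    rw [← card_cubeVertices]
    exact (Finset.card_eq_sum_card_fiberwise fun v _ => Finset.mem_univ (φ v)).symm
  have hshift : ∀ t, ∑ j, (X (j + t)).card = 2 ^ k := fun t =>
    (Equiv.sum_comp (Equiv.addRight t) fun j => (X j).card).trans hsum
  have h1 : (1 : Fin (n + 3)) ≠ 0 := by simp
  have h2 : (1 + 1 : Fin (n + 3)) ≠ 0 := by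
    simp [Fin.ext_iff, Fin.val_add, Nat.mod_eq_of_lt]
  have hloc : ∀ j, (X j).card + (X (j + 1)).card + (X (j + (1 + 1))).card ≤ 4 := by
    intro j
    rw [← Finset.card_union_of_disjoint (hdisj _ _ (fun h => h1 (left_eq_add.mp h))),
      ← Finset.card_union_of_disjoint]
    · refine (Finset.card_le_card ?_).trans
        (card_three_links_le (N j) (N (j + 1)) (N (j + 1 + 1)) (N (j + 1 + 1 + 1)))
      rw [← add_assoc]
      exact Finset.union_subset_union (Finset.union_subset_union (hX _) (hX _)) (hX _)
    · rw [Finset.disjoint_union_left]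
      exact ⟨hdisj _ _ (fun h => h2 (left_eq_add.mp h)), hdisj _ _ (fun h => h1 (left_eq_add.mp (add_left_cancel h)))⟩
  have := Finset.sum_le_sum fun j (_ : j ∈ Finset.univ) => hloc j
  rw [Finset.sum_add_distrib, Finset.sum_add_distrib, hsum, hshift, hshift] at this
  simp at this
  omega

theorem three_mul_two_pow_le_of_closed_cover {k m : ℕ} (hk : 2 ≤ k)
    (S : Fin (m + 1) → Fin k → ℝ) (hS : S (Fin.last m) = S 0)
    (hcov : ∀ v ∈ cubeVertices k, ∃ j : Fin m, v ∈ segment ℝ (S j.castSucc) (S j.succ)) :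
    3 * 2 ^ k ≤ 4 * m := by
  have h4 : 2 ^ 2 ≤ 2 ^ k := Nat.pow_le_pow_right (by norm_num) hk
  have hsmall : ∀ A B : Fin k → ℝ, ¬ cubeVertices k ⊆ linkVertices A B := by
    intro A B hsub
    have := (Finset.card_le_card hsub).trans (card_linkVertices_le_two A B)
    rw [card_cubeVertices] at this
    omega
  match m, S, hS, hcov with
  | 0, S, hS, hcov =>
    exact absurd (fun v hv => (hcov v hv).elim fun j _ => j.elim0) (hsmall 0 0)
  | 1, S, hS, hcov =>
    refine absurd (fun v hv => ?_) (hsmall (S 0) (S 1))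
    obtain ⟨j, hj⟩ := hcov v hv
    fin_cases j
    exact mem_linkVertices.mpr ⟨hv, hj⟩
  | 2, S, hS, hcov =>
    refine absurd (fun v hv => ?_) (hsmall (S 0) (S 1))
    obtain ⟨j, hj⟩ := hcov v hv
    fin_cases j
    · exact mem_linkVertices.mpr ⟨hv, hj⟩
    · rw [linkVertices_comm, ← hS]
      exact mem_linkVertices.mpr ⟨hv, hj⟩
  | n + 3, S, hS, hcov =>
    refine three_mul_two_pow_le_of_cyclic_cover (fun j => S j.castSucc) fun v hv => ?_
    obtain ⟨j, hj⟩ := hcov v hv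
    refine ⟨j, ?_⟩
    have : S (j + 1).castSucc = S j.succ := by
      refine Fin.lastCases ?_ (fun i => ?_) j
      · rw [Fin.last_add_one, Fin.succ_last, hS, Fin.castSucc_zero]
      · rw [Fin.coeSucc_eq_succ, Fin.succ_castSucc]
    simpa only [this] using hj

/-- The apex common to all triangles of the covering chain. -/
noncomputable def apex (n : ℕ) : Fin (n + 2) → ℝ := fun i => if i = 0 then 2 else 1 / 2

/-- The intersection with `x₀ = 0` of the line through the apex and the vertex with `x₀ = 1`
and remaining coordinates those of `w`. -/
noncomputable def basePoint {n : ℕ} (w : Fin (n + 2) → ℝ) : Fin (n + 2) → ℝ :=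
  fun i => if i = 0 then 0 else 2 * w i - 1 / 2

theorem mem_segment_apex_basePoint {n : ℕ} {v w : Fin (n + 2) → ℝ} (h0 : v 0 = 1)
    (h : ∀ i, i ≠ 0 → v i = w i) : v ∈ segment ℝ (apex n) (basePoint w) := by
  refine ⟨1 / 2, 1 / 2, by norm_num, by norm_num, by norm_num, ?_⟩
  ext i
  by_cases hi : i = 0
  · subst hi
    simp [apex, basePoint, h0]
  · simp [apex, basePoint, hi, h i hi]
    ring

theorem mem_segment_basePoint_basePoint {n : ℕ} {v w : Fin (n + 2) → ℝ} (h0 : v 0 = 0)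
    (h : ∀ i, i ≠ 0 → v i = w i) :
    v ∈ segment ℝ (basePoint w) (basePoint fun i => 1 - w i) := by
  refine ⟨3 / 4, 1 / 4, by norm_num, by norm_num, by norm_num, ?_⟩
  ext i
  by_cases hi : i = 0
  · subst hi
    simp [basePoint, h0]
  · simp [basePoint, hi, h i hi]
    ring

/-- An enumeration of the hypercube vertices up to the first coordinate and antipodality. -/
theorem exists_enumeration (n : ℕ) : ∃ w : ℕ → Fin (n + 2) → ℝ,
    ∀ v ∈ cubeVertices (n + 2), ∃ t < 2 ^ n,
      (∀ i, i ≠ 0 → v i = w t i) ∨ ∀ i, i ≠ 0 → v i = 1 - w t i := by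
  have hcard : Fintype.card (Fin n → Bool) = 2 ^ n := by simp
  let e := Fintype.equivFinOfCardEq hcard
  let tail : (Fin n → Bool) → Fin (n + 2) → ℝ := fun f =>
    Fin.cons 0 (Fin.cons 0 fun i => if f i then 1 else 0)
  obtain ⟨w, hw⟩ : ∃ w : ℕ → Fin (n + 2) → ℝ, ∀ f, ∃ t < 2 ^ n, w t = tail f :=
    ⟨fun t => if h : t < 2 ^ n then tail (e.symm ⟨t, h⟩) else 0, fun f => ⟨e f, (e f).2, by simp⟩⟩
  refine ⟨w, fun v hv => ?_⟩
  rw [mem_cubeVertices] at hv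
  rcases hv 1 with h1 | h1
  · obtain ⟨t, ht, hwt⟩ := hw fun i => decide (v i.succ.succ = 1)
    refine ⟨t, ht, Or.inl fun i => ?_⟩
    rw [hwt]
    refine Fin.cases (fun h => absurd rfl h) (fun i _ => ?_) i
    refine Fin.cases ?_ (fun i => ?_) i
    · simpa [tail] using h1
    · rcases hv i.succ.succ with h | h <;> simp [tail, h]
  · obtain ⟨t, ht, hwt⟩ := hw fun i => decide (v i.succ.succ = 0)
    refine ⟨t, ht, Or.inr fun i => ?_⟩
    rw [hwt]
    refine Fin.cases (fun h => absurd rfl h) (fun i _ => ?_) i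
    refine Fin.cases ?_ (fun i => ?_) i
    · simpa [tail] using h1
    · rcases hv i.succ.succ with h | h <;> simp [tail, h]

/-- The nodes of a chain running through the triangles with the given apex whose bases carry the
diagonals given by `w`. -/
noncomputable def triangleChain {n : ℕ} (w : ℕ → Fin (n + 2) → ℝ) (j : ℕ) : Fin (n + 2) → ℝ :=
  if j % 3 = 0 then apex n
  else if j % 3 = 1 then basePoint (w (j / 3)) else basePoint fun i => 1 - w (j / 3) i

theorem exists_closed_cover (n : ℕ) : ∃ S : Fin (3 * 2 ^ n + 1) → Fin (n + 2) → ℝ,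
    S (Fin.last (3 * 2 ^ n)) = S 0 ∧
    ∀ v ∈ cubeVertices (n + 2), ∃ j : Fin (3 * 2 ^ n),
      v ∈ segment ℝ (S j.castSucc) (S j.succ) := by
  obtain ⟨w, hw⟩ := exists_enumeration n
  refine ⟨fun j => triangleChain w j, by simp [triangleChain], fun v hv => ?_⟩
  obtain ⟨t, ht, h⟩ := hw v hv
  have e0 : triangleChain w (3 * t) = apex n := by simp [triangleChain]
  have e1 : triangleChain w (3 * t + 1) = basePoint (w t) := by
    simp [triangleChain, Nat.add_mod, show (3 * t + 1) / 3 = t by omega]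
  have e2 : triangleChain w (3 * t + 2) = basePoint fun i => 1 - w t i := by
    simp [triangleChain, Nat.add_mod, show (3 * t + 2) / 3 = t by omega]
  have e3 : triangleChain w (3 * t + 3) = apex n := by simp [triangleChain]
  rcases mem_cubeVertices.mp hv 0 with h0 | h0
  · refine ⟨⟨3 * t + 1, by omega⟩, ?_⟩
    simp only [Fin.val_castSucc, Fin.val_succ, e1, e2]
    rcases h with h | h
    · exact mem_segment_basePoint_basePoint h0 h
    · rw [segment_symm]
      simpa using mem_segment_basePoint_basePoint (w := fun i => 1 - w t i) h0 h
  · rcases h with h | h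
    · refine ⟨⟨3 * t, by omega⟩, ?_⟩
      simp only [Fin.val_castSucc, Fin.val_succ, e0, e1]
      exact mem_segment_apex_basePoint h0 h
    · refine ⟨⟨3 * t + 2, by omega⟩, ?_⟩
      simp only [Fin.val_castSucc, Fin.val_succ, e2, e3]
      rw [segment_symm]
      exact mem_segment_apex_basePoint h0 h

/-- For every `k ≥ 2`, the minimum number of links of a *closed* polygonal
chain in `ℝ^k` covering the vertex set `{0,1}^k` equals `3 · 2^(k-2)`. -/
theorem min_links_closed_covering_chain_eq (k : ℕ) (hk : 2 ≤ k) :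
    IsLeast {m : ℕ | ∃ S : Fin (m + 1) → (Fin k → ℝ),
      S (Fin.last m) = S 0 ∧
      ∀ v : Fin k → ℝ, (∀ i, v i = 0 ∨ v i = 1) →
        ∃ j : Fin m, v ∈ segment ℝ (S j.castSucc) (S j.succ)}
      (3 * 2 ^ (k - 2)) := by
  obtain ⟨n, rfl⟩ := Nat.exists_eq_add_of_le' hk
  constructor
  · obtain ⟨S, hS, hcov⟩ := exists_closed_cover n
    exact ⟨S, hS, fun v hv => hcov v (mem_cubeVertices.mpr hv)⟩
  · rintro m ⟨S, hS, hcov⟩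
    have := three_mul_two_pow_le_of_closed_cover hk S hS
      fun v hv => hcov v (mem_cubeVertices.mp hv)
    rw [pow_add] at this
    simp only [Nat.add_sub_cancel]
    omega
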